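/- arXiv:2312.11287 — 2 statements merged into one kernel-verified Lean document; each statement's English description precedes it below -/
import Mathlib

section
/- Let G be a connected bipartite graph with n vertices, where n is even. Then N(P_G) ≥ 2^{n/2+1} − 2, and equality holds if and only if G is the complete bipartite graph K_{n/2,n/2}. -/
open Finset

/-- The symmetric edge polytope of a finite simple graph `G`: the convex hull of the
vectors `e_i - e_j` for all adjacent pairs `i, j`. -/
def symEdgePolytope {V : Type*} [DecidableEq V] (G : SimpleGraph V) : Set (V → ℝ) :=
  convexHull ℝ {x : V → ℝ | ∃ i j : V, G.Adj i j ∧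
    x = fun k => (if k = i then (1 : ℝ) else 0) - (if k = j then (1 : ℝ) else 0)}

/-- A facet of a polytope `P`: a maximal proper (exposed) face of `P`. -/
def IsFacet {V : Type*} (P F : Set (V → ℝ)) : Prop :=
  IsExposed ℝ P F ∧ F ≠ P ∧
    ∀ F' : Set (V → ℝ), IsExposed ℝ P F' → F' ≠ P → F ⊆ F' → F' = F

/-- `N(P)`: the number of facets of a polytope `P`. -/
noncomputable def numFacets {V : Type*} (P : Set (V → ℝ)) : ℕ :=
  Set.ncard {F : Set (V → ℝ) | IsFacet P F}

namespace SEP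

variable {V : Type*} [Fintype V] [DecidableEq V]

def gen (i j : V) : V → ℝ :=
  fun k => (if k = i then (1 : ℝ) else 0) - (if k = j then (1 : ℝ) else 0)

omit [Fintype V] in
lemma gen_mem {G : SimpleGraph V} {i j : V} (h : G.Adj i j) : gen i j ∈ symEdgePolytope G :=
  subset_convexHull ℝ _ ⟨i, j, h, rfl⟩

omit [Fintype V] in
lemma gen_eq (i j : V) : gen i j = Pi.single i 1 - Pi.single j 1 := by
  funext k; simp [gen, Pi.single_apply]

omit [Fintype V] in
lemma le_of_gen {G : SimpleGraph V} (l : (V → ℝ) →L[ℝ] ℝ) (M : ℝ)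
    (h : ∀ i j, G.Adj i j → l (gen i j) ≤ M) : ∀ x ∈ symEdgePolytope G, l x ≤ M := by
  have : symEdgePolytope G ⊆ {x | l x ≤ M} := by
    apply convexHull_min
    · rintro x ⟨i, j, hij, rfl⟩
      exact h i j hij
    · exact convex_halfSpace_le l.toLinearMap.isLinear M
  exact this

def dot (f : V → ℝ) : (V → ℝ) →L[ℝ] ℝ := ∑ v, f v • ContinuousLinearMap.proj v

lemma dot_gen (f : V → ℝ) (i j : V) : dot f (gen i j) = f i - f j := by
  simp [dot, gen, mul_sub, Finset.sum_sub_distrib]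

/-- height functions -/
def IsHt (G : SimpleGraph V) (f : V → ℤ) : Prop :=
  ∀ i j, G.Adj i j → f i - f j = 1 ∨ f j - f i = 1

def face (G : SimpleGraph V) (f : V → ℤ) : Set (V → ℝ) :=
  {x | x ∈ symEdgePolytope G ∧ dot (fun v => (f v : ℝ)) x = 1}

lemma dot_le {G : SimpleGraph V} {f : V → ℤ} (hf : IsHt G f) :
    ∀ x ∈ symEdgePolytope G, dot (fun v => (f v : ℝ)) x ≤ 1 := by
  apply le_of_gen
  intro i j hij
  rw [dot_gen]
  have : f i - f j ≤ 1 := by rcases hf i j hij with h | h <;> omega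
  exact_mod_cast this

lemma gen_mem_face {G : SimpleGraph V} {f : V → ℤ} {i j : V} (h : G.Adj i j) :
    gen i j ∈ face G f ↔ f i - f j = 1 := by
  constructor
  · rintro ⟨_, h2⟩
    rw [dot_gen] at h2
    exact_mod_cast h2
  · intro h2
    refine ⟨gen_mem h, ?_⟩
    rw [dot_gen]
    exact_mod_cast h2

lemma face_nonempty {G : SimpleGraph V} {f : V → ℤ} (hf : IsHt G f) {i j : V} (h : G.Adj i j) :
    (face G f).Nonempty := by
  rcases hf i j h with h' | h'
  · exact ⟨_, (gen_mem_face h).2 h'⟩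
  · exact ⟨_, (gen_mem_face h.symm).2 h'⟩

lemma face_exposed {G : SimpleGraph V} {f : V → ℤ} (hf : IsHt G f) {i j : V} (h : G.Adj i j) :
    IsExposed ℝ (symEdgePolytope G) (face G f) := by
  intro _
  refine ⟨dot (fun v => (f v : ℝ)), ?_⟩
  ext x
  constructor
  · rintro ⟨hx, h1⟩
    exact ⟨hx, fun y hy => h1 ▸ dot_le hf y hy⟩
  · rintro ⟨hx, h1⟩
    refine ⟨hx, le_antisymm (dot_le hf x hx) ?_⟩
    obtain ⟨y, hy, hy1⟩ := face_nonempty hf h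
    exact hy1 ▸ h1 y hy

lemma face_ne {G : SimpleGraph V} {f : V → ℤ} (hf : IsHt G f) {i j : V} (h : G.Adj i j) :
    face G f ≠ symEdgePolytope G := by
  intro e
  have h1 := gen_mem h
  have h2 := gen_mem h.symm
  rw [← e, gen_mem_face h] at h1
  rw [← e, gen_mem_face h.symm] at h2
  omega

omit [Fintype V] in
lemma gen_neg (l : (V → ℝ) →L[ℝ] ℝ) (i j : V) : l (gen j i) = - l (gen i j) := by
  simp [gen_eq]

omit [Fintype V] in
/-- normal form of proper nonempty exposed faces -/
lemma exposed_form {G : SimpleGraph V} {F : Set (V → ℝ)} (hF : IsExposed ℝ (symEdgePolytope G) F)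
    (hne : F.Nonempty) (hp : F ≠ symEdgePolytope G) :
    ∃ l : (V → ℝ) →L[ℝ] ℝ, (∀ x ∈ symEdgePolytope G, l x ≤ 1) ∧
      F = {x | x ∈ symEdgePolytope G ∧ l x = 1} := by
  obtain ⟨l, rfl⟩ := hF hne
  obtain ⟨x0, hx0, hmax⟩ := hne
  have hpos : 0 < l x0 := by
    by_contra hcon
    push Not at hcon
    apply hp
    have hg : ∀ i j, G.Adj i j → l (gen i j) = 0 := by
      intro i j hij
      have h1 := hmax _ (gen_mem hij)
      have h2 := hmax _ (gen_mem hij.symm)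
      rw [gen_neg] at h2
      linarith
    have h1 := le_of_gen (G := G) l 0 (fun i j h => (hg i j h).le)
    have h2 := le_of_gen (G := G) (-l) 0 (fun i j h => by simp [hg i j h])
    have h0 : ∀ x ∈ symEdgePolytope G, l x = 0 := fun x hx => by
      have := h1 x hx
      have := h2 x hx
      simp at this
      linarith
    ext x
    constructor
    · exact fun h => h.1
    · intro hx
      refine ⟨hx, fun y hy => ?_⟩
      rw [h0 x hx, h0 y hy]
  refine ⟨(l x0)⁻¹ • l, ?_, ?_⟩
  · intro x hx
    have := hmax x hx
    simp only [ContinuousLinearMap.smul_apply, smul_eq_mul]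
    rw [inv_mul_le_iff₀ hpos]; linarith
  · ext x
    simp only [ContinuousLinearMap.smul_apply, smul_eq_mul, Set.mem_setOf_eq]
    refine and_congr_right fun hx => ?_
    rw [inv_mul_eq_iff_eq_mul₀ hpos.ne', mul_one]
    constructor
    · intro h
      exact le_antisymm (hmax x hx) (h x0 hx0)
    · intro h y hy
      rw [h]; exact hmax y hy

lemma face_facet {G : SimpleGraph V} {f : V → ℤ} (hf : IsHt G f) {i j : V} (h : G.Adj i j) :
    IsFacet (symEdgePolytope G) (face G f) := by
  refine ⟨face_exposed hf h, face_ne hf h, ?_⟩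
  intro F' hF' hne hsub
  obtain ⟨l, hl, rfl⟩ := exposed_form hF' ((face_nonempty hf h).mono hsub) hne
  have hg : ∀ i j, G.Adj i j → l (gen i j) = dot (fun v => (f v : ℝ)) (gen i j) := by
    intro i j hij
    rcases hf i j hij with h' | h'
    · have h1 := (gen_mem_face hij).2 h'
      rw [(hsub h1).2, h1.2]
    · have h1 := (gen_mem_face hij.symm).2 h'
      rw [gen_neg, gen_neg (dot _), (hsub h1).2, h1.2]
  have h1 := le_of_gen (G := G) (l - dot (fun v => (f v : ℝ))) 0 (fun i j h => by simp [hg i j h])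
  have h2 := le_of_gen (G := G) (dot (fun v => (f v : ℝ)) - l) 0 (fun i j h => by simp [hg i j h])
  ext x
  refine and_congr_right fun hx => ?_
  have := h1 x hx
  have := h2 x hx
  simp only [ContinuousLinearMap.sub_apply] at *
  have e : l x = dot (fun v => (f v : ℝ)) x := by linarith
  rw [e]

/-- rounding -/
lemma exists_round {G : SimpleGraph V} (c : V → Bool) (hc : ∀ i j, G.Adj i j → c i ≠ c j)
    (g : V → ℝ) (hg : ∀ i j, G.Adj i j → g i - g j ≤ 1) :
    ∃ f : V → ℤ, IsHt G f ∧ ∀ i j, G.Adj i j → g i - g j = 1 → f i - f j = 1 := by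
  let b : V → ℤ := fun v => if c v then 1 else 0
  let q : V → ℤ := fun v => ⌊(g v - b v) / 2⌋
  have hb : ∀ i j, G.Adj i j → (b i = 1 ∧ b j = 0) ∨ (b i = 0 ∧ b j = 1) := by
    intro i j h
    have := hc i j h
    simp only [b]
    cases h1 : c i <;> cases h2 : c j <;> simp_all
  have hq1 : ∀ v, 2 * (q v : ℝ) + b v ≤ g v := by
    intro v
    have := Int.floor_le ((g v - b v) / 2)
    simp only [q]; linarith
  have hq2 : ∀ v, g v < 2 * (q v : ℝ) + b v + 2 := by
    intro v
    have := Int.lt_floor_add_one ((g v - b v) / 2)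
    simp only [q]; linarith
  have key : ∀ i j, G.Adj i j → (2 * q i + b i) - (2 * q j + b j) < 3 := by
    intro i j h
    have h1 := hq1 i
    have h2 := hq2 j
    have h3 := hg i j h
    have : ((2 * q i + b i : ℤ) : ℝ) - ((2 * q j + b j : ℤ) : ℝ) < 3 := by push_cast; linarith
    exact_mod_cast this
  refine ⟨fun v => 2 * q v + b v, ?_, ?_⟩
  · intro i j h
    have h1 := key i j h
    have h2 := key j i h.symm
    have h3 := hb i j h
    simp only
    omega
  · intro i j h hij
    have h1 := key i j h
    have h3 := hb i j h
    have h4 : -1 < (2 * q i + b i) - (2 * q j + b j) := by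
      have h1 := hq2 i
      have h2 := hq1 j
      have : (-1:ℝ) < ((2 * q i + b i : ℤ) : ℝ) - ((2 * q j + b j : ℤ) : ℝ) := by
        push_cast; linarith
      exact_mod_cast this
    simp only
    omega

lemma facet_face {G : SimpleGraph V} (c : V → Bool) (hc : ∀ i j, G.Adj i j → c i ≠ c j)
    {i0 j0 : V} (h0 : G.Adj i0 j0) {F : Set (V → ℝ)} (hF : IsFacet (symEdgePolytope G) F) :
    ∃ f : V → ℤ, IsHt G f ∧ face G f = F := by
  obtain ⟨hexp, hne, hmax⟩ := hF
  have hnon : F.Nonempty := by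
    rw [Set.nonempty_iff_ne_empty]
    rintro rfl
    obtain ⟨f, hf, -⟩ := exists_round c hc (fun _ => (0 : ℝ)) (by simp)
    have := hmax _ (face_exposed hf h0) (face_ne hf h0) (Set.empty_subset _)
    exact (face_nonempty hf h0).ne_empty this
  obtain ⟨l, hl, rfl⟩ := exposed_form hexp hnon hne
  have hgen : ∀ i j, l (gen i j) = l (Pi.single i 1) - l (Pi.single j 1) := by
    intro i j; rw [gen_eq, map_sub]
  obtain ⟨f, hf, hfg⟩ := exists_round c hc (fun v => l (Pi.single v 1)) (by
    intro i j h
    have := hl _ (gen_mem h)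
    rwa [hgen] at this)
  refine ⟨f, hf, hmax _ (face_exposed hf h0) (face_ne hf h0) ?_⟩
  -- the constant K
  have hK : ∃ K : ℝ, ∀ p : V × V, G.Adj p.1 p.2 →
      1 - dot (fun v => (f v : ℝ)) (gen p.1 p.2) ≤ K * (1 - l (gen p.1 p.2)) := by
    have : ∀ p : V × V, ∃ k : ℝ, ∀ K, k ≤ K → G.Adj p.1 p.2 →
      1 - dot (fun v => (f v : ℝ)) (gen p.1 p.2) ≤ K * (1 - l (gen p.1 p.2)) := by
      intro p
      by_cases hp : G.Adj p.1 p.2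
      · rcases (hl _ (gen_mem hp)).lt_or_eq with h | h
        · refine ⟨(1 - dot (fun v => (f v : ℝ)) (gen p.1 p.2)) / (1 - l (gen p.1 p.2)), ?_⟩
          intro K hK _
          rwa [div_le_iff₀ (by linarith)] at hK
        · refine ⟨0, fun K _ _ => ?_⟩
          have h' := h
          rw [hgen] at h'
          have := (gen_mem_face hp).2 (hfg _ _ hp h')
          rw [h, this.2]; simp
      · exact ⟨0, fun _ _ h => absurd h hp⟩
    choose k hk using this
    obtain ⟨K, hK⟩ := Finset.exists_le (Finset.univ.image k)
    exact ⟨K, fun p => hk p K (hK _ (Finset.mem_image_of_mem _ (Finset.mem_univ p)))⟩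
  obtain ⟨K, hK⟩ := hK
  have h3 := le_of_gen (G := G) (K • l - dot (fun v => (f v : ℝ))) (K - 1) (by
    intro i j hij
    have := hK (i, j) hij
    simp only [ContinuousLinearMap.sub_apply, ContinuousLinearMap.smul_apply, smul_eq_mul] at *
    linarith)
  rintro x ⟨hx, hx1⟩
  refine ⟨hx, le_antisymm (dot_le hf x hx) ?_⟩
  have := h3 x hx
  simp only [ContinuousLinearMap.sub_apply, ContinuousLinearMap.smul_apply, smul_eq_mul, hx1] at this
  linarith

/-- pinned height functions -/
def Ht (G : SimpleGraph V) (v0 : V) : Set (V → ℤ) := {f | f v0 = 0 ∧ IsHt G f}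

lemma face_shift {G : SimpleGraph V} (f : V → ℤ) (k : ℤ) :
    face G (fun v => f v - k) = face G f := by
  have h1 := le_of_gen (G := G) (dot (fun v => ((f v - k : ℤ) : ℝ)) - dot (fun v => (f v : ℝ))) 0
    (fun i j h => by simp [dot_gen])
  have h2 := le_of_gen (G := G) (dot (fun v => (f v : ℝ)) - dot (fun v => ((f v - k : ℤ) : ℝ))) 0
    (fun i j h => by simp [dot_gen])
  ext x
  refine and_congr_right fun hx => ?_
  have := h1 x hx
  have := h2 x hx
  simp only [ContinuousLinearMap.sub_apply] at *
  have e : dot (fun v => ((f v - k : ℤ) : ℝ)) x = dot (fun v => (f v : ℝ)) x := by linarith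
  rw [e]

lemma face_inj {G : SimpleGraph V} (hG : G.Connected) (v0 : V) :
    Set.InjOn (face G) (Ht G v0) := by
  rintro f ⟨hf0, hf⟩ g ⟨hg0, hg⟩ hfg
  have hadj : ∀ i j, G.Adj i j → f i - f j = g i - g j := by
    intro i j hij
    rcases hf i j hij with h | h
    · have := (gen_mem_face hij).2 h
      rw [hfg, gen_mem_face hij] at this
      omega
    · have := (gen_mem_face hij.symm).2 h
      rw [hfg, gen_mem_face hij.symm] at this
      omega
  have hw : ∀ u v, G.Walk u v → f u - f v = g u - g v := by
    intro u v w
    induction w with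
    | nil => simp
    | cons h _ ih =>
      have := hadj _ _ h
      omega
  funext v
  obtain ⟨w⟩ := hG.preconnected v v0
  have := hw _ _ w
  omega

lemma numFacets_eq {G : SimpleGraph V} (hG : G.Connected) (c : V → Bool)
    (hc : ∀ i j, G.Adj i j → c i ≠ c j) {i0 j0 : V} (h0 : G.Adj i0 j0) (v0 : V) :
    numFacets (symEdgePolytope G) = (Ht G v0).ncard := by
  rw [← (face_inj hG v0).ncard_image, numFacets]
  congr 1
  ext F
  constructor
  · intro hF
    obtain ⟨f, hf, rfl⟩ := facet_face c hc h0 hF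
    refine ⟨fun v => f v - f v0, ⟨by simp, ?_⟩, face_shift f _⟩
    intro i j h
    have := hf i j h
    simp only
    omega
  · rintro ⟨f, ⟨_, hf⟩, rfl⟩
    exact face_facet hf h0

lemma Ht_finite {G : SimpleGraph V} (hG : G.Connected) (v0 : V) : (Ht G v0).Finite := by
  have hw : ∀ f, IsHt G f → ∀ u v, ∀ w : G.Walk u v, |f u - f v| ≤ w.length := by
    intro f hf u v w
    induction w with
    | nil => simp
    | cons h _ ih =>
      have := hf _ _ h
      rw [abs_le] at *
      simp only [SimpleGraph.Walk.length_cons]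
      push_cast
      omega
  have w : ∀ v, Nonempty (G.Walk v v0) := fun v => hG.preconnected v v0
  have hfin : (Set.pi Set.univ (fun v => Set.Icc (-((w v).some.length : ℤ)) ((w v).some.length))).Finite :=
    Set.Finite.pi' (fun v => Set.finite_Icc _ _) |>.subset (by
      intro f hf v; exact hf v trivial)
  refine hfin.subset ?_
  rintro f ⟨hf0, hf⟩ v _
  have := hw f hf v v0 (w v).some
  rw [hf0, abs_le] at this
  simp only [Set.mem_Icc]
  omega

/-- the two-coloured complete bipartite graph -/
def KG (c : V → Bool) : SimpleGraph V where
  Adj u v := c u ≠ c v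
  symm := ⟨fun _ _ h => h.symm⟩
  loopless := ⟨fun _ h => h rfl⟩

def phi (c : V → Bool) (s : Bool) (v0 : V) (S : Finset V) : V → ℤ :=
  fun v => (if c v = s then (if v ∈ S then 1 else -1) else 0)
    - (if c v0 = s then (if v0 ∈ S then 1 else -1) else 0)

def cls (c : V → Bool) (s : Bool) : Finset V := Finset.univ.filter (fun v => c v = s)

lemma phi_inj (c : V → Bool) (s : Bool) (v0 w : V) (hw : c w ≠ s) :
    Set.InjOn (phi c s v0) ((cls c s).powerset : Set (Finset V)) := by
  intro S hS T hT h
  simp only [Finset.coe_powerset, Set.mem_preimage, Set.mem_powerset_iff, Finset.coe_subset] at hS hT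
  have hww := congrFun h w
  ext v
  by_cases hv : c v = s
  · have hvv := congrFun h v
    simp only [phi, hw, hv, if_true, if_false] at hvv hww
    by_cases h1 : v ∈ S <;> by_cases h2 : v ∈ T <;> simp only [h1, h2, if_true, if_false] at hvv ⊢ <;> omega
  · constructor
    · intro h1; exact absurd (by simpa [cls] using hS h1) hv
    · intro h1; exact absurd (by simpa [cls] using hT h1) hv

lemma phi_ncard (c : V → Bool) (s : Bool) (v0 w : V) (hw : c w ≠ s) :
    (phi c s v0 '' ((cls c s).powerset : Set (Finset V))).ncard = 2 ^ (cls c s).card := by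
  rw [(phi_inj c s v0 w hw).ncard_image, Set.ncard_coe_finset, Finset.card_powerset]

lemma Ht_KG (c : V → Bool) (v0 a b : V) (ha : c a = true) (hb : c b = false) :
    Ht (KG c) v0 = phi c true v0 '' ((cls c true).powerset : Set (Finset V)) ∪
      phi c false v0 '' ((cls c false).powerset : Set (Finset V)) := by
  -- if `f` is constant off class `s`, then `f` is in the image
  have main : ∀ s : Bool, ∀ f, f v0 = 0 → IsHt (KG c) f → ∀ w, c w ≠ s →
      (∀ v, c v ≠ s → f v = f w) →
      f ∈ phi c s v0 '' ((cls c s).powerset : Set (Finset V)) := by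
    intro s f hf0 hf w hw hconst
    refine ⟨(cls c s).filter (fun v => f v = f w + 1),
      Finset.mem_coe.2 (Finset.mem_powerset.2 (Finset.filter_subset _ _)), ?_⟩
    have hval : ∀ v, (if c v = s then (if v ∈ (cls c s).filter (fun v => f v = f w + 1)
        then (1:ℤ) else -1) else 0) = f v - f w := by
      intro v
      by_cases hv : c v = s
      · have := hf v w (show c v ≠ c w by rw [hv]; exact hw.symm)
        simp only [hv, cls, Finset.mem_filter, Finset.mem_univ, true_and, if_true]
        split_ifs <;> omega
      · simp [hv, hconst v hv]
    funext v
    simp only [phi]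
    rw [hval, hval]
    omega
  apply Set.Subset.antisymm
  · rintro f ⟨hf0, hf⟩
    by_cases h : ∀ v, c v ≠ true → f v = f b
    · exact Or.inl (main true f hf0 hf b (by simp [hb]) h)
    · right
      push Not at h
      obtain ⟨b', hb', hne⟩ := h
      refine main false f hf0 hf a (by simp [ha]) ?_
      intro v hv
      have hv' : c v = true := by simpa using hv
      have hb2 : c b' = false := by simpa using hb'
      have h1 := hf v b (show c v ≠ c b by simp [hv', hb])
      have h2 := hf v b' (show c v ≠ c b' by simp [hv', hb2])
      have h3 := hf a b (show c a ≠ c b by simp [ha, hb])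
      have h4 := hf a b' (show c a ≠ c b' by simp [ha, hb2])
      omega
  · have : ∀ s S, phi c s v0 S ∈ Ht (KG c) v0 := by
      intro s S
      refine ⟨by simp [phi], ?_⟩
      intro i j (hij : c i ≠ c j)
      simp only [phi]
      by_cases hi : c i = s
      · have hj : c j ≠ s := fun h => hij (hi.trans h.symm)
        simp only [hi, hj, if_true, if_false]
        split_ifs <;> omega
      · have hj : c j = s := by
          revert hij hi; cases c i <;> cases c j <;> cases s <;> simp
        simp only [hi, hj, if_true, if_false]
        split_ifs <;> omega
    rintro f (⟨S, _, rfl⟩ | ⟨S, _, rfl⟩) <;> exact this _ _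

lemma phi_inter (c : V → Bool) (v0 a b : V) (ha : c a = true) (hb : c b = false) :
    phi c true v0 '' ((cls c true).powerset : Set (Finset V)) ∩
      phi c false v0 '' ((cls c false).powerset : Set (Finset V)) =
    {phi c true v0 ∅, phi c true v0 (cls c true)} := by
  have e1 : phi c false v0 (cls c false) = phi c true v0 ∅ := by
    funext v
    simp only [phi, cls, Finset.mem_filter, Finset.mem_univ, true_and]
    cases c v <;> cases c v0 <;> simp
  have e2 : phi c false v0 ∅ = phi c true v0 (cls c true) := by
    funext v
    simp only [phi, cls, Finset.mem_filter, Finset.mem_univ, true_and]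
    cases c v <;> cases c v0 <;> simp
  apply Set.Subset.antisymm
  · rintro f ⟨⟨S, hS, rfl⟩, ⟨T, hT, hST⟩⟩
    simp only [Finset.coe_powerset, Set.mem_preimage, Set.mem_powerset_iff, Finset.coe_subset] at hS hT
    have key : ∀ u v, c u = true → c v = false → (u ∈ S ↔ v ∉ T) := by
      intro u v hu hv
      have h1 := congrFun hST u
      have h2 := congrFun hST v
      simp only [phi, hu, hv] at h1 h2
      by_cases h3 : u ∈ S <;> by_cases h4 : v ∈ T <;> simp [h3, h4] at h1 h2 ⊢ <;> omega
    by_cases hbT : b ∈ T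
    · left
      congr 1
      rw [Finset.eq_empty_iff_forall_notMem]
      intro u hu
      have : c u = true := by simpa [cls] using hS hu
      exact (key u b this hb).1 hu hbT
    · right
      rw [Set.mem_singleton_iff]
      congr 1
      apply Finset.Subset.antisymm hS
      intro u hu
      exact (key u b (by simpa [cls] using hu) hb).2 hbT
  · rintro f (rfl | rfl)
    · exact ⟨⟨∅, by simp, rfl⟩, ⟨_, by simp, e1⟩⟩
    · exact ⟨⟨_, by simp, rfl⟩, ⟨∅, by simp, e2⟩⟩

lemma Ht_KG_ncard (c : V → Bool) (v0 a b : V) (ha : c a = true) (hb : c b = false) :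
    (Ht (KG c) v0).ncard + 2 = 2 ^ (cls c true).card + 2 ^ (cls c false).card := by
  rw [Ht_KG c v0 a b ha hb, ← phi_ncard c true v0 b (by simp [hb]),
    ← phi_ncard c false v0 a (by simp [ha]),
    ← Set.ncard_union_add_ncard_inter _ _ ((Finset.finite_toSet _).image _)
      ((Finset.finite_toSet _).image _), phi_inter c v0 a b ha hb, Set.ncard_pair]
  intro h
  have := phi_inj c true v0 b (by simp [hb]) (by simp) (by simp) h
  have h2 : a ∈ cls c true := by simp [cls, ha]
  rw [← this] at h2
  simp at h2

/-- the distance function is a height function -/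
lemma dist_isHt {G : SimpleGraph V} (hG : G.Connected) (c : V → Bool)
    (hc : ∀ i j, G.Adj i j → c i ≠ c j) (u : V) :
    IsHt G (fun v => (G.dist u v : ℤ)) ∧ ∀ v, (Even (G.dist u v) ↔ c u = c v) := by
  have hwalk : ∀ u v, ∀ w : G.Walk u v, (Even w.length ↔ c u = c v) := by
    intro u v w
    induction w with
    | nil => simp
    | @cons x y z h _ ih =>
      have := hc _ _ h
      rw [SimpleGraph.Walk.length_cons, Nat.even_add_one, ih]
      cases hx : c x <;> cases hy : c y <;> cases hz : c z <;> simp_all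
  have hev : ∀ v, (Even (G.dist u v) ↔ c u = c v) := by
    intro v
    obtain ⟨w, hw⟩ := hG.exists_walk_length_eq_dist u v
    rw [← hw]; exact hwalk _ _ w
  refine ⟨?_, hev⟩
  intro i j hij
  have h1 := hG.dist_triangle (u := u) (v := i) (w := j)
  have h2 := hG.dist_triangle (u := u) (v := j) (w := i)
  rw [SimpleGraph.dist_eq_one_iff_adj.2 hij] at h1
  rw [SimpleGraph.dist_eq_one_iff_adj.2 hij.symm] at h2
  have h3 : G.dist u i ≠ G.dist u j := by
    intro e
    have h4 := hev i
    rw [e, hev j] at h4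
    have := hc _ _ hij
    revert h4 this
    cases c u <;> cases c i <;> cases c j <;> simp
  simp only
  omega

lemma Ht_mono {G : SimpleGraph V} (c : V → Bool)
    (hc : ∀ i j, G.Adj i j → c i ≠ c j) (v0 : V) : Ht (KG c) v0 ⊆ Ht G v0 :=
  fun _ hf => ⟨hf.1, fun i j h => hf.2 i j (hc i j h)⟩

lemma adj_of_Ht_eq {G : SimpleGraph V} (hG : G.Connected) (c : V → Bool)
    (hc : ∀ i j, G.Adj i j → c i ≠ c j) (v0 : V) (h : Ht (KG c) v0 = Ht G v0) (u v : V)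
    (huv : c u ≠ c v) : G.Adj u v := by
  obtain ⟨h1, -⟩ := dist_isHt hG c hc u
  have h3 : (fun v => (G.dist u v : ℤ) - G.dist u v0) ∈ Ht G v0 := by
    refine ⟨by simp, fun i j hij => ?_⟩
    have := h1 i j hij
    simp only at this ⊢
    omega
  rw [← h] at h3
  have h4 := h3.2 u v huv
  simp only [SimpleGraph.dist_self] at h4
  rw [← SimpleGraph.dist_eq_one_iff_adj]
  omega

lemma pow_ineq (a b m : ℕ) (h : a + b = 2 * m) :
    2 ^ (m + 1) ≤ 2 ^ a + 2 ^ b ∧ (2 ^ a + 2 ^ b = 2 ^ (m + 1) → a = m ∧ b = m) := by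
  by_cases hab : a = b
  · have : a = m := by omega
    have : b = m := by omega
    subst a; subst b
    refine ⟨by rw [pow_succ]; omega, fun _ => ⟨rfl, rfl⟩⟩
  · have hlt : 2 ^ (m + 1) < 2 ^ a + 2 ^ b := by
      rcases Nat.lt_or_gt_of_ne hab with h' | h'
      · have : 2 ^ (m+1) ≤ 2 ^ b := Nat.pow_le_pow_right (by norm_num) (by omega)
        have : 0 < 2 ^ a := by positivity
        omega
      · have : 2 ^ (m+1) ≤ 2 ^ a := Nat.pow_le_pow_right (by norm_num) (by omega)
        have : 0 < 2 ^ b := by positivity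
        omega
    exact ⟨hlt.le, fun h => by omega⟩

omit [DecidableEq V] in
lemma cls_card_add (c : V → Bool) : (cls c true).card + (cls c false).card = Fintype.card V := by
  have := Finset.card_filter_add_card_filter_not (s := (Finset.univ : Finset V)) (fun v => c v = true)
  simpa [cls] using this

end SEP

open SEP in
/-- Let `G` be a connected bipartite graph with `n` vertices, `n` even. Then
`N(P_G) ≥ 2^(n/2+1) - 2`, with equality iff `G = K_{n/2, n/2}`. -/
theorem even_bipartite_lower_bound (n : ℕ) (hn : Even n) (G : SimpleGraph (Fin n))
    (hG : G.Connected) (hbip : G.Colorable 2) :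
    2 ^ (n / 2 + 1) - 2 ≤ numFacets (symEdgePolytope G) ∧
      (numFacets (symEdgePolytope G) = 2 ^ (n / 2 + 1) - 2 ↔
        Nonempty (G ≃g completeBipartiteGraph (Fin (n / 2)) (Fin (n / 2)))) := by
  obtain ⟨m, rfl⟩ := hn
  have hm : (m + m) / 2 = m := by omega
  rw [hm]
  obtain ⟨v0⟩ := hG.nonempty
  have hm0 : 0 < m := by have := v0.2; omega
  have : Nontrivial (Fin (m + m)) := Fin.nontrivial_iff_two_le.2 (by omega)
  obtain ⟨j0, h0⟩ := hG.preconnected.exists_adj_of_nontrivial v0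
  obtain ⟨col⟩ := hbip
  have hcc : ∀ i j, G.Adj i j → decide (col i = 0) ≠ decide (col j = 0) := by
    intro i j h
    have := col.valid h
    revert this
    generalize col i = x
    generalize col j = y
    revert x y
    decide
  have hends : ∀ c : Fin (m + m) → Bool, (∀ i j, G.Adj i j → c i ≠ c j) →
      ∃ a b, c a = true ∧ c b = false := by
    intro c hc
    have := hc _ _ h0
    cases h1 : c v0 <;> cases h2 : c j0
    · simp_all
    · exact ⟨_, _, h2, h1⟩
    · exact ⟨_, _, h1, h2⟩
    · simp_all
  constructor
  · generalize hcdef : (fun i => decide (col i = 0)) = c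
    have hc : ∀ i j, G.Adj i j → c i ≠ c j := by subst hcdef; exact hcc
    obtain ⟨a, b, ha, hb⟩ := hends c hc
    rw [numFacets_eq hG c hc h0 v0]
    have h1 := Set.ncard_le_ncard (Ht_mono c hc v0) (Ht_finite hG v0)
    have h2 := Ht_KG_ncard c v0 a b ha hb
    have h3 := cls_card_add c
    rw [Fintype.card_fin] at h3
    have h4 := (pow_ineq _ _ m (h3.trans (two_mul m).symm)).1
    rw [← h2] at h4
    omega
  constructor
  · intro heq
    generalize hcdef : (fun i => decide (col i = 0)) = c
    have hc : ∀ i j, G.Adj i j → c i ≠ c j := by subst hcdef; exact hcc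
    obtain ⟨a, b, ha, hb⟩ := hends c hc
    rw [numFacets_eq hG c hc h0 v0] at heq
    have h1 := Set.ncard_le_ncard (Ht_mono c hc v0) (Ht_finite hG v0)
    have h2 := Ht_KG_ncard c v0 a b ha hb
    have h3 := cls_card_add c
    rw [Fintype.card_fin] at h3
    replace h3 := h3.trans (two_mul m).symm
    obtain ⟨h4, h5⟩ := pow_ineq _ _ m h3
    have h6 : 2 ≤ 2 ^ (m + 1) := by
      rw [pow_succ]; have : 0 < 2 ^ m := by positivity
      omega
    obtain ⟨hA, hB⟩ := h5 (by omega)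
    have h7 := Set.eq_of_subset_of_ncard_le (Ht_mono c hc v0) (by omega) (Ht_finite hG v0)
    have hadj : ∀ u v, G.Adj u v ↔ c u ≠ c v := fun u v =>
      ⟨hc u v, adj_of_Ht_eq hG c hc v0 h7 u v⟩
    have eA : {v // c v = true} ≃ Fin m := Fintype.equivFinOfCardEq (by
      rw [Fintype.card_subtype]; exact hA)
    have eB : {v // ¬ c v = true} ≃ Fin m := Fintype.equivFinOfCardEq (by
      rw [Fintype.card_subtype]; simpa [cls] using hB)
    refine ⟨⟨(Equiv.sumCompl (fun v => c v = true)).symm.trans (Equiv.sumCongr eA eB), ?_⟩⟩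
    intro u v
    rw [hadj]
    by_cases hu : c u = true <;> by_cases hv : c v = true
    · simp [Equiv.sumCompl_symm_apply_of_pos, hu, hv]
    · simp [Equiv.sumCompl_symm_apply_of_pos, Equiv.sumCompl_symm_apply_of_neg, hu, hv]
    · simp [Equiv.sumCompl_symm_apply_of_pos, Equiv.sumCompl_symm_apply_of_neg, hu, hv]
    · simp [Equiv.sumCompl_symm_apply_of_neg, hu, hv]
  · rintro ⟨e⟩
    let c : Fin (m + m) → Bool := fun v => (e v).isLeft
    have hadj : ∀ u v, G.Adj u v ↔ c u ≠ c v := by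
      intro u v
      rw [← e.map_adj_iff]
      simp only [c]
      rcases e u with x | x <;> rcases e v with y | y <;> simp
    have hc : ∀ i j, G.Adj i j → c i ≠ c j := fun i j => (hadj i j).1
    obtain ⟨a, b, ha, hb⟩ := hends c hc
    have hGK : G = KG c := by
      ext u v; exact hadj u v
    rw [numFacets_eq hG c hc h0 v0]
    have h2 := Ht_KG_ncard c v0 a b ha hb
    rw [← hGK] at h2
    have hA : (cls c true).card = m := by
      have himg : cls c true = (Finset.univ : Finset (Fin m)).image
          (fun x => e.symm (Sum.inl x)) := by
        ext v
        simp only [cls, c, Finset.mem_filter, Finset.mem_univ, true_and, Finset.mem_image]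
        constructor
        · intro h
          obtain ⟨x, hx⟩ := Sum.isLeft_iff.1 h
          exact ⟨x, by rw [← hx]; simp⟩
        · rintro ⟨x, rfl⟩; simp
      rw [himg, Finset.card_image_of_injective]
      · simp
      · intro x y h
        exact Sum.inl_injective (e.symm.injective h)
    have h3 := cls_card_add c
    rw [Fintype.card_fin] at h3
    have hB : (cls c false).card = m := by omega
    rw [hA, hB] at h2
    rw [pow_succ]
    omega
end

section
/- Say that a connected graph H with m ≥ 3 vertices satisfies the Braun–Bruegge bounds if: 3·2^{(m−1)/2} − 2 ≤ N(P_H) ≤ 6^{(m−1)/2} when m is odd, and 2^{m/2+1} − 2 ≤ N(P_H) ≤ 14·6^{m/2−2} when m is even; a graph with 2 vertices (an edge) also qualifies, with N(P_{K_2}) = 2. If G is the 1-sum of connected graphs G₁ and G₂ (each with at least 2 vertices) and both G₁ and G₂ satisfy the corresponding lower and upper bounds, then G satisfies the Braun–Bruegge bounds for its number n = n₁ + n₂ − 1 of vertices. -/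
open Finset

/-- `G` is the 1-sum (wedge) of `G₁` and `G₂`: `G` is the union of induced copies of
`G₁` and `G₂` sharing exactly one common vertex. -/
def IsOneSum {V V₁ V₂ : Type*} (G : SimpleGraph V) (G₁ : SimpleGraph V₁)
    (G₂ : SimpleGraph V₂) : Prop :=
  ∃ (f₁ : V₁ → V) (f₂ : V₂ → V),
    Function.Injective f₁ ∧ Function.Injective f₂ ∧
    Set.range f₁ ∪ Set.range f₂ = Set.univ ∧
    (∃ v : V, Set.range f₁ ∩ Set.range f₂ = {v}) ∧
    (∀ a b : V₁, G.Adj (f₁ a) (f₁ b) ↔ G₁.Adj a b) ∧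
    (∀ a b : V₂, G.Adj (f₂ a) (f₂ b) ↔ G₂.Adj a b) ∧
    (∀ x y : V, G.Adj x y →
      (x ∈ Set.range f₁ ∧ y ∈ Set.range f₁) ∨ (x ∈ Set.range f₂ ∧ y ∈ Set.range f₂))

/-- The Braun–Bruegge bounds for a connected graph with `m` vertices whose symmetric edge
polytope has `N` facets; a graph with `2` vertices (an edge) qualifies with `N = 2`. -/
def BBBounds (m N : ℕ) : Prop :=
  (m = 2 ∧ N = 2) ∨
    (3 ≤ m ∧
      (Odd m → 3 * 2 ^ ((m - 1) / 2) - 2 ≤ N ∧ N ≤ 6 ^ ((m - 1) / 2)) ∧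
      (Even m → 2 ^ (m / 2 + 1) - 2 ≤ N ∧ N ≤ 14 * 6 ^ (m / 2 - 2)))

theorem bb_cases {m N : ℕ} (h : BBBounds m N) : (m = 2 ∧ N = 2) ∨
    (∃ a, m = 2 * a + 3 ∧ 6 * 2 ^ a ≤ N + 2 ∧ N ≤ 6 * 6 ^ a) ∨
    (∃ a, m = 2 * a + 4 ∧ 8 * 2 ^ a ≤ N + 2 ∧ N ≤ 14 * 6 ^ a) := by
  rcases h with h | ⟨h3, ho, he⟩
  · exact Or.inl h
  right
  rcases Nat.even_or_odd m with hm | hm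
  · right
    obtain ⟨k, rfl⟩ := id hm
    obtain ⟨a, rfl⟩ : ∃ a, k = a + 2 := ⟨k - 2, by omega⟩
    obtain ⟨h1, h2⟩ := he hm
    have e1 : (a + 2 + (a + 2)) / 2 = a + 2 := by omega
    rw [e1] at h1 h2
    refine ⟨a, by omega, ?_, by simpa using h2⟩
    have : 2 ^ (a + 2 + 1) = 8 * 2 ^ a := by ring
    omega
  · left
    obtain ⟨k, rfl⟩ := id hm
    obtain ⟨a, rfl⟩ : ∃ a, k = a + 1 := ⟨k - 1, by omega⟩
    obtain ⟨h1, h2⟩ := ho hm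
    have e1 : (2 * (a + 1) + 1 - 1) / 2 = a + 1 := by omega
    rw [e1] at h1 h2
    refine ⟨a, by omega, ?_, ?_⟩
    · have : 2 ^ (a + 1) = 2 * 2 ^ a := by ring
      omega
    · rw [pow_succ] at h2; omega

theorem bb_odd {m N a : ℕ} (hm : m = 2 * a + 3) (h1 : 6 * 2 ^ a ≤ N + 2) (h2 : N ≤ 6 * 6 ^ a) :
    BBBounds m N := by
  subst hm
  refine Or.inr ⟨by omega, fun _ => ?_, fun h => ?_⟩
  · have e1 : (2 * a + 3 - 1) / 2 = a + 1 := by omega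
    rw [e1, pow_succ, pow_succ]; omega
  · rw [Nat.even_iff] at h; omega

theorem bb_even {m N a : ℕ} (hm : m = 2 * a + 4) (h1 : 8 * 2 ^ a ≤ N + 2) (h2 : N ≤ 14 * 6 ^ a) :
    BBBounds m N := by
  subst hm
  refine Or.inr ⟨by omega, fun h => ?_, fun _ => ?_⟩
  · rw [Nat.odd_iff] at h; omega
  · have e1 : (2 * a + 4) / 2 = a + 2 := by omega
    have : 2 ^ (a + 2 + 1) = 8 * 2 ^ a := by ring
    rw [e1, this, Nat.add_sub_cancel]; omega

theorem bb_mul {m k N M : ℕ} (h1 : BBBounds m N) (h2 : BBBounds k M) :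
    BBBounds (m + k - 1) (N * M) := by
  have p2 : ∀ a : ℕ, 1 ≤ 2 ^ a := fun a => Nat.one_le_two_pow
  have p6 : ∀ a : ℕ, 1 ≤ 6 ^ a := fun a => Nat.one_le_pow _ _ (by norm_num)
  rcases bb_cases h1 with ⟨rfl, rfl⟩ | ⟨a, rfl, l1, u1⟩ | ⟨a, rfl, l1, u1⟩ <;>
  rcases bb_cases h2 with ⟨rfl, rfl⟩ | ⟨b, rfl, l2, u2⟩ | ⟨b, rfl, l2, u2⟩
  · exact bb_odd (a := 0) (by omega) (by norm_num) (by norm_num)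
  · have := p2 b; have := p6 b
    exact bb_even (a := b) (by omega) (by omega) (by omega)
  · have := p2 b; have := p6 b
    exact bb_odd (a := b + 1) (by omega) (by rw [pow_succ]; omega) (by rw [pow_succ]; omega)
  · have := p2 a; have := p6 a
    exact bb_even (a := a) (by omega) (by omega) (by omega)
  · have := p2 a; have := p2 b; have hu := Nat.mul_le_mul u1 u2
    refine bb_odd (a := a + b + 1) (by omega) ?_ (hu.trans (le_of_eq (by ring)))
    obtain ⟨x, hx⟩ := Nat.exists_eq_add_of_le this
    obtain ⟨y, hy⟩ := Nat.exists_eq_add_of_le (p2 a)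
    have hl := Nat.mul_le_mul (show 6 * 2 ^ a - 2 ≤ N by omega) (show 6 * 2 ^ b - 2 ≤ M by omega)
    rw [pow_succ, pow_add, hx, hy] at *
    have e1 : 6 * (1 + y) - 2 = 4 + 6 * y := by omega
    have e2 : 6 * (1 + x) - 2 = 4 + 6 * x := by omega
    rw [e1, e2] at hl
    nlinarith [Nat.zero_le (x * y)]
  · have := p2 a; have := p2 b; have hu := Nat.mul_le_mul u1 u2
    refine bb_even (a := a + b + 1) (by omega) ?_ (hu.trans (le_of_eq (by ring)))
    obtain ⟨x, hx⟩ := Nat.exists_eq_add_of_le this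
    obtain ⟨y, hy⟩ := Nat.exists_eq_add_of_le (p2 a)
    have hl := Nat.mul_le_mul (show 6 * 2 ^ a - 2 ≤ N by omega) (show 8 * 2 ^ b - 2 ≤ M by omega)
    rw [pow_succ, pow_add, hx, hy] at *
    have e1 : 6 * (1 + y) - 2 = 4 + 6 * y := by omega
    have e2 : 8 * (1 + x) - 2 = 6 + 8 * x := by omega
    rw [e1, e2] at hl
    nlinarith [Nat.zero_le (x * y)]
  · have := p2 a; have := p6 a
    exact bb_odd (a := a + 1) (by omega) (by rw [pow_succ]; omega) (by rw [pow_succ]; omega)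
  · have := p2 a; have := p2 b; have hu := Nat.mul_le_mul u1 u2
    refine bb_even (a := a + b + 1) (by omega) ?_ (hu.trans (le_of_eq (by ring)))
    obtain ⟨x, hx⟩ := Nat.exists_eq_add_of_le this
    obtain ⟨y, hy⟩ := Nat.exists_eq_add_of_le (p2 a)
    have hl := Nat.mul_le_mul (show 8 * 2 ^ a - 2 ≤ N by omega) (show 6 * 2 ^ b - 2 ≤ M by omega)
    rw [pow_succ, pow_add, hx, hy] at *
    have e1 : 8 * (1 + y) - 2 = 6 + 8 * y := by omega
    have e2 : 6 * (1 + x) - 2 = 4 + 6 * x := by omega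
    rw [e1, e2] at hl
    nlinarith [Nat.zero_le (x * y)]
  · have := p2 a; have := p2 b; have hu := Nat.mul_le_mul u1 u2
    refine bb_odd (a := a + b + 2) (by omega) ?_ (hu.trans ?_)
    · obtain ⟨x, hx⟩ := Nat.exists_eq_add_of_le this
      obtain ⟨y, hy⟩ := Nat.exists_eq_add_of_le (p2 a)
      have hl := Nat.mul_le_mul (show 8 * 2 ^ a - 2 ≤ N by omega) (show 8 * 2 ^ b - 2 ≤ M by omega)
      rw [pow_add, pow_add, hx, hy] at *
      have e1 : 8 * (1 + y) - 2 = 6 + 8 * y := by omega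
      have e2 : 8 * (1 + x) - 2 = 6 + 8 * x := by omega
      rw [e1, e2] at hl
      nlinarith [Nat.zero_le (x * y)]
    · rw [pow_add, pow_add]; nlinarith [Nat.zero_le (6 ^ a * 6 ^ b)]

/-- The edge vector `e_i - e_j`. -/
def edgeVec {V : Type*} [DecidableEq V] (i j : V) : V → ℝ :=
  fun k => (if k = i then (1 : ℝ) else 0) - (if k = j then (1 : ℝ) else 0)

/-- Tight sets of directed edges for feasible potentials. -/
def tightSets {V : Type*} (G : SimpleGraph V) : Set (Set (V × V)) :=
  {T | ∃ u : V → ℝ, (∀ i j, G.Adj i j → u i - u j ≤ 1) ∧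
    T = {p | G.Adj p.1 p.2 ∧ u p.1 - u p.2 = 1}}

theorem ncard_maximal_eq {α β : Type*} [PartialOrder α] [PartialOrder β] (s : Set α) (t : Set β)
    (f : α → β) (hm : ∀ x ∈ s, f x ∈ t) (hs : ∀ y ∈ t, ∃ x ∈ s, f x = y)
    (ho : ∀ x ∈ s, ∀ y ∈ s, f x ≤ f y ↔ x ≤ y) :
    {x | Maximal (· ∈ s) x}.ncard = {y | Maximal (· ∈ t) y}.ncard := by
  have himg : f '' {x | Maximal (· ∈ s) x} = {y | Maximal (· ∈ t) y} := by
    ext y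
    constructor
    · rintro ⟨x, hx, rfl⟩
      refine ⟨hm x hx.1, fun z hz hle => ?_⟩
      obtain ⟨w, hw, rfl⟩ := hs z hz
      exact (ho w hw x hx.1).2 (hx.2 hw ((ho x hx.1 w hw).1 hle))
    · rintro hy
      obtain ⟨x, hx, rfl⟩ := hs y hy.1
      refine ⟨x, ⟨hx, fun w hw hle => ?_⟩, rfl⟩
      exact (ho w hw x hx).1 (hy.2 (hm w hw) ((ho x hx w hw).2 hle))
  rw [← himg, Set.InjOn.ncard_image]
  intro x hx y hy hxy
  exact le_antisymm ((ho x hx.1 y hy.1).1 hxy.le) ((ho y hy.1 x hx.1).1 hxy.ge)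

theorem symEdgePolytope_eq {V : Type*} [DecidableEq V] (G : SimpleGraph V) :
    symEdgePolytope G = convexHull ℝ {x : V → ℝ | ∃ i j : V, G.Adj i j ∧ x = edgeVec i j} := rfl

theorem edgeVec_mem {V : Type*} [DecidableEq V] {G : SimpleGraph V} {i j : V} (h : G.Adj i j) :
    edgeVec i j ∈ symEdgePolytope G :=
  subset_convexHull ℝ _ ⟨i, j, h, rfl⟩

theorem edgeVec_neg {V : Type*} [DecidableEq V] (i j : V) : edgeVec j i = - edgeVec i j := by
  ext k; simp [edgeVec]

theorem edgeVec_eq_single {V : Type*} [DecidableEq V] (i j : V) :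
    edgeVec i j = Pi.single i 1 - Pi.single j 1 := by
  ext k; simp [edgeVec, Pi.single_apply]

theorem zero_mem_sep {V : Type*} [DecidableEq V] {G : SimpleGraph V} {i j : V} (h : G.Adj i j) :
    (0 : V → ℝ) ∈ symEdgePolytope G := by
  have hc : Convex ℝ (symEdgePolytope G) := convex_convexHull ℝ _
  have := hc (edgeVec_mem h) (edgeVec_mem h.symm) (a := 1 / 2) (b := 1 / 2)
    (by norm_num) (by norm_num) (by norm_num)
  rw [edgeVec_neg] at this
  simpa using this

theorem isCompact_sep {V : Type*} [Fintype V] [DecidableEq V] (G : SimpleGraph V) :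
    IsCompact (symEdgePolytope G) := by
  rw [symEdgePolytope_eq]
  apply Set.Finite.isCompact_convexHull
  refine (Set.finite_range (fun p : V × V => edgeVec p.1 p.2)).subset ?_
  rintro x ⟨i, j, -, rfl⟩
  exact ⟨(i, j), rfl⟩

theorem numFacets_eq_tight {V : Type*} [Fintype V] [DecidableEq V] (G : SimpleGraph V)
    (hG : ∃ i j, G.Adj i j) :
    numFacets (symEdgePolytope G) = {T | Maximal (· ∈ tightSets G) T}.ncard := by
  obtain ⟨i₀, j₀, h₀⟩ := hG
  have hc : Convex ℝ (symEdgePolytope G) := convex_convexHull ℝ _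
  have hK := isCompact_sep G
  rw [← ncard_maximal_eq {F | IsExposed ℝ (symEdgePolytope G) F ∧ F ≠ symEdgePolytope G}
    (tightSets G) (fun F => {p | G.Adj p.1 p.2 ∧ edgeVec p.1 p.2 ∈ F})]
  · unfold numFacets
    congr 1
    ext F
    constructor
    · rintro ⟨h1, h2, h3⟩
      exact ⟨⟨h1, h2⟩, fun F' hF' hle => (h3 F' hF'.1 hF'.2 hle).le⟩
    · rintro ⟨⟨h1, h2⟩, h3⟩
      exact ⟨h1, h2, fun F' hF' hF'2 hle => subset_antisymm (h3 ⟨hF', hF'2⟩ hle) hle⟩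
  · rintro F ⟨hF, hne⟩
    rcases F.eq_empty_or_nonempty with rfl | hFn
    · refine ⟨0, by simp, ?_⟩
      ext p; simp
    · obtain ⟨l, hl⟩ := hF hFn
      obtain ⟨x, hx⟩ := hFn
      have hx' := hx
      rw [hl] at hx'
      have hM0 : 0 ≤ l x := by simpa using hx'.2 0 (zero_mem_sep h₀)
      have hmem : ∀ y ∈ symEdgePolytope G, y ∈ F ↔ l y = l x := by
        intro y hy
        rw [hl]
        constructor
        · intro h
          exact le_antisymm (hx'.2 y hy) (h.2 x hx'.1)
        · intro h
          exact ⟨hy, fun z hz => h ▸ hx'.2 z hz⟩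
      have hM : 0 < l x := by
        rcases hM0.lt_or_eq with h | h
        · exact h
        · exfalso
          apply hne
          apply subset_antisymm hF.subset
          rw [symEdgePolytope_eq]
          apply convexHull_min _ (hF.convex hc)
          rintro y ⟨i, j, hij, rfl⟩
          rw [hmem _ (edgeVec_mem hij)]
          have h1 := hx'.2 _ (edgeVec_mem hij)
          have h2 := hx'.2 _ (edgeVec_mem hij.symm)
          rw [edgeVec_neg, map_neg] at h2
          linarith
      have key : ∀ i j, l (Pi.single i 1) / l x - l (Pi.single j 1) / l x
          = l (edgeVec i j) / l x := by
        intro i j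
        rw [edgeVec_eq_single, map_sub, sub_div]
      refine ⟨fun i => l (Pi.single i 1) / l x, ?_, ?_⟩
      · intro i j hij
        rw [key, div_le_one hM]
        exact hx'.2 _ (edgeVec_mem hij)
      · ext p
        simp only [Set.mem_ofPred_eq, key]
        refine and_congr_right fun hp => ?_
        rw [hmem _ (edgeVec_mem hp), div_eq_one_iff_eq hM.ne']
  · rintro T ⟨u, hu, rfl⟩
    let l : (V → ℝ) →L[ℝ] ℝ := ∑ i, u i • ContinuousLinearMap.proj i
    have hl : ∀ i j, l (edgeVec i j) = u i - u j := by
      intro i j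
      simp [l, edgeVec, mul_sub, Finset.sum_sub_distrib]
    have hle : ∀ y ∈ symEdgePolytope G, l y ≤ 1 := by
      intro y hy
      have : symEdgePolytope G ⊆ {y | l y ≤ 1} := by
        rw [symEdgePolytope_eq]
        apply convexHull_min _ (convex_halfSpace_le l.toLinearMap.isLinear 1)
        rintro y ⟨i, j, hij, rfl⟩
        exact (hl i j).trans_le (hu i j hij)
      exact this hy
    refine ⟨{x ∈ symEdgePolytope G | l x = 1}, ⟨?_, ?_⟩, ?_⟩
    · rintro ⟨x, hx, hx1⟩
      refine ⟨l, ?_⟩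
      ext y
      constructor
      · rintro ⟨hy, hy1⟩
        exact ⟨hy, fun z hz => hy1 ▸ hle z hz⟩
      · rintro ⟨hy, hy1⟩
        exact ⟨hy, le_antisymm (hle y hy) (hx1 ▸ hy1 x hx)⟩
    · intro h
      have := zero_mem_sep h₀
      rw [← h] at this
      simpa using this.2
    · ext p
      simp only [Set.mem_ofPred_eq, hl]
      constructor
      · rintro ⟨h1, h2, h3⟩
        exact ⟨h1, h3⟩
      · rintro ⟨h1, h3⟩
        exact ⟨h1, edgeVec_mem h1, h3⟩
  · rintro F ⟨hF, -⟩ F' ⟨hF', -⟩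
    constructor
    · intro h
      have hFK := hF.isCompact hK
      have hF'K := hF'.isCompact hK
      have e := closure_convexHull_extremePoints hFK (hF.convex hc)
      change F ⊆ F'
      rw [← e]
      refine closure_minimal (convexHull_min ?_ (hF'.convex hc)) hF'K.isClosed
      rw [hF.isExtreme.extremePoints_eq]
      rintro x ⟨hxF, hx⟩
      obtain ⟨i, j, hij, rfl⟩ := extremePoints_convexHull_subset hx
      exact (@h (i, j) ⟨hij, hxF⟩).2
    · rintro h p ⟨h1, h2⟩
      exact ⟨h1, h h2⟩

theorem tight_oneSum {V V₁ V₂ : Type*}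
    (G : SimpleGraph V) (G₁ : SimpleGraph V₁) (G₂ : SimpleGraph V₂) (h : IsOneSum G G₁ G₂) :
    {T | Maximal (· ∈ tightSets G) T}.ncard =
      {T | Maximal (· ∈ tightSets G₁) T}.ncard * {T | Maximal (· ∈ tightSets G₂) T}.ncard := by
  obtain ⟨f₁, f₂, i₁, i₂, -, ⟨v, hv⟩, a₁, a₂, hE⟩ := h
  have hprod : {T : Set (V₁ × V₁) | Maximal (· ∈ tightSets G₁) T} ×ˢ
      {T : Set (V₂ × V₂) | Maximal (· ∈ tightSets G₂) T} =
      {q | Maximal (· ∈ tightSets G₁ ×ˢ tightSets G₂) q} := by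
    ext ⟨q₁, q₂⟩
    constructor
    · rintro ⟨h1, h2⟩
      exact ⟨⟨h1.1, h2.1⟩, fun r hr hle => ⟨h1.2 hr.1 hle.1, h2.2 hr.2 hle.2⟩⟩
    · rintro ⟨⟨h1, h2⟩, h3⟩
      exact ⟨⟨h1, fun r hr hle => (@h3 (r, q₂) ⟨hr, h2⟩ ⟨hle, le_rfl⟩).1⟩,
        ⟨h2, fun r hr hle => (@h3 (q₁, r) ⟨h1, hr⟩ ⟨le_rfl, hle⟩).2⟩⟩
  rw [← Set.ncard_prod, hprod]
  apply ncard_maximal_eq _ _ (fun T => (Prod.map f₁ f₁ ⁻¹' T, Prod.map f₂ f₂ ⁻¹' T))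
  · rintro T ⟨u, hu, rfl⟩
    refine ⟨⟨u ∘ f₁, fun i j hij => hu _ _ ((a₁ i j).2 hij), ?_⟩,
      ⟨u ∘ f₂, fun i j hij => hu _ _ ((a₂ i j).2 hij), ?_⟩⟩
    · ext p; simp [a₁]
    · ext p; simp [a₂]
  · rintro ⟨T₁, T₂⟩ ⟨⟨u₁, hu₁, hT₁⟩, ⟨u₂, hu₂, hT₂⟩⟩
    dsimp only at hT₁ hT₂
    subst hT₁ hT₂
    have hv' : v ∈ Set.range f₁ ∩ Set.range f₂ := by rw [hv]; rfl
    obtain ⟨⟨c₁, hc₁⟩, ⟨c₂, hc₂⟩⟩ := hv'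
    let u : V → ℝ := Function.extend f₁ (fun a => u₁ a - u₁ c₁)
      (Function.extend f₂ (fun b => u₂ b - u₂ c₂) 0)
    have e₁ : ∀ a, u (f₁ a) = u₁ a - u₁ c₁ := fun a => i₁.extend_apply _ _ a
    have e₂ : ∀ b, u (f₂ b) = u₂ b - u₂ c₂ := by
      intro b
      by_cases hb : ∃ a, f₁ a = f₂ b
      · have hbv : f₂ b ∈ Set.range f₁ ∩ Set.range f₂ := ⟨hb, ⟨b, rfl⟩⟩
        rw [hv] at hbv
        have hbv' : f₂ b = v := hbv
        have hbc : b = c₂ := i₂ (hbv'.trans hc₂.symm)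
        rw [hbv', ← hc₁, e₁, hbc]; simp
      · simp only [u]
        rw [Function.extend_apply' _ _ _ hb, i₂.extend_apply]
    refine ⟨_, ⟨u, ?_, rfl⟩, ?_⟩
    · intro x y hxy
      rcases hE x y hxy with ⟨⟨a, rfl⟩, ⟨b, rfl⟩⟩ | ⟨⟨a, rfl⟩, ⟨b, rfl⟩⟩
      · rw [e₁, e₁]; linarith [hu₁ a b ((a₁ a b).1 hxy)]
      · rw [e₂, e₂]; linarith [hu₂ a b ((a₂ a b).1 hxy)]
    · ext p
      · simp [a₁, e₁]
      · simp [a₂, e₂]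
  · rintro T ⟨u, hu, rfl⟩ T' ⟨u', hu', rfl⟩
    constructor
    · rintro ⟨h1, h2⟩ ⟨x, y⟩ hp
      rcases hE x y hp.1 with ⟨⟨a, rfl⟩, ⟨b, rfl⟩⟩ | ⟨⟨a, rfl⟩, ⟨b, rfl⟩⟩
      · exact @h1 (a, b) hp
      · exact @h2 (a, b) hp
    · intro h
      exact ⟨Set.preimage_mono h, Set.preimage_mono h⟩

theorem exists_adj_of_card {V : Type*} [Fintype V] (G : SimpleGraph V) (h : G.Connected)
    (hn : 2 ≤ Fintype.card V) : ∃ i j, G.Adj i j := by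
  by_contra hcon
  push Not at hcon
  have : Nontrivial V := Fintype.one_lt_card_iff_nontrivial.1 hn
  have hb : G = ⊥ := by
    ext i j; simp [hcon]
  subst hb
  exact SimpleGraph.not_connected_bot h

/-- If `G` is the 1-sum of connected graphs `G₁` and `G₂` (each with at
least 2 vertices) both of which satisfy the Braun–Bruegge bounds, then `G` satisfies the
Braun–Bruegge bounds for its number `n = n₁ + n₂ - 1` of vertices. -/
theorem bbBounds_oneSum {V V₁ V₂ : Type*} [Fintype V] [DecidableEq V]
    [Fintype V₁] [DecidableEq V₁] [Fintype V₂] [DecidableEq V₂]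
    (G : SimpleGraph V) (G₁ : SimpleGraph V₁) (G₂ : SimpleGraph V₂)
    (h₁ : G₁.Connected) (h₂ : G₂.Connected) (h : IsOneSum G G₁ G₂)
    (hn₁ : 2 ≤ Fintype.card V₁) (hn₂ : 2 ≤ Fintype.card V₂)
    (hb₁ : BBBounds (Fintype.card V₁) (numFacets (symEdgePolytope G₁)))
    (hb₂ : BBBounds (Fintype.card V₂) (numFacets (symEdgePolytope G₂))) :
    BBBounds (Fintype.card V₁ + Fintype.card V₂ - 1) (numFacets (symEdgePolytope G)) := by
  have hG₁ := exists_adj_of_card G₁ h₁ hn₁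
  have hG₂ := exists_adj_of_card G₂ h₂ hn₂
  have hG : ∃ i j, G.Adj i j := by
    obtain ⟨f₁, f₂, -, -, -, -, a₁, -, -⟩ := id h
    obtain ⟨i, j, hij⟩ := hG₁
    exact ⟨f₁ i, f₁ j, (a₁ i j).2 hij⟩
  rw [numFacets_eq_tight G hG, tight_oneSum G G₁ G₂ h, ← numFacets_eq_tight G₁ hG₁,
    ← numFacets_eq_tight G₂ hG₂]
  exact bb_mul hb₁ hb₂
end
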